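/- Let R1 and R2 be relations over attribute sets U1 and U2, let u¹ ∈ U1 ∖ U2 and u² ∈ U2 ∖ U1, and let F be a filter over U1 ∪ U2 that does not contain u². Then π_{(U1 ∪ U2) ∖ {u²}}(R1 ⟕_F ν_{u¹↦u²} R2) ≡ R1 ⟕_F R2[u¹/u²], where R2[u¹/u²] denotes R2 with attribute u² renamed to u¹. -/

import Mathlib

noncomputable section
open Classical

attribute [local instance 10] Classical.propDecidable

namespace RA

variable {A Δ : Type} [DecidableEq A] [DecidableEq Δ]

/-- Three-valued logic: true, false, unknown (error). -/
inductive TV where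
  | tt | ff | unk
deriving DecidableEq

/-- Kleene conjunction. -/
def TV.and : TV → TV → TV
  | .ff, _ => .ff
  | _, .ff => .ff
  | .tt, .tt => .tt
  | _, _ => .unk

/-- Kleene negation. -/
def TV.not : TV → TV
  | .tt => .ff
  | .ff => .tt
  | .unk => .unk

mutual
/-- Terms over attributes `A` and domain `Δ`: attributes, constants and conditionals. -/
inductive Term (A Δ : Type) where
  | attr : A → Term A Δ
  | const : Δ → Term A Δ
  | ite : Filter A Δ → Term A Δ → Term A Δ → Term A Δ

/-- RA filters: `isNull` on a (finite) set of terms, equality, conjunction, negation. -/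
inductive Filter (A Δ : Type) where
  | isNull : List (Term A Δ) → Filter A Δ
  | eq : Term A Δ → Term A Δ → Filter A Δ
  | and : Filter A Δ → Filter A Δ → Filter A Δ
  | not : Filter A Δ → Filter A Δ
end

/-- Disjunction: `F1 ∨ F2 = ¬(¬F1 ∧ ¬F2)`. -/
def Filter.or (F1 F2 : Filter A Δ) : Filter A Δ := .not ((Filter.not F1).and (Filter.not F2))

/-- The tautological filter ⊤ (`isNull` of the empty set of terms is always true). -/
def Filter.tru : Filter A Δ := .isNull []

/-- A tuple over a set of attributes: `none` marks attributes outside the set. -/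
abbrev Tuple (A Δ : Type) := A → Option Δ

mutual
/-- Evaluation of a term on a tuple (`null` is the distinguished null value of `Δ`). -/
def Term.eval (null : Δ) (t : Tuple A Δ) : Term A Δ → Δ
  | .attr a => (t a).getD null
  | .const c => c
  | .ite F v v' => if F.eval null t = TV.tt then v.eval null t else v'.eval null t

def Term.evalList (null : Δ) (t : Tuple A Δ) : List (Term A Δ) → List Δ
  | [] => []
  | v :: vs => v.eval null t :: Term.evalList null t vs

/-- Three-valued evaluation of a filter on a tuple. -/
def Filter.eval (null : Δ) (t : Tuple A Δ) : Filter A Δ → TV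
  | .isNull V => if ∀ d ∈ Term.evalList null t V, d = null then .tt else .ff
  | .eq v v' =>
      if v.eval null t = null ∨ v'.eval null t = null then .unk
      else if v.eval null t = v'.eval null t then .tt else .ff
  | .and F1 F2 => (F1.eval null t).and (F2.eval null t)
  | .not F => (F.eval null t).not
end

mutual
/-- Attributes occurring in a term. -/
def Term.attrs : Term A Δ → Finset A
  | .attr a => {a}
  | .const _ => ∅
  | .ite F v v' => F.attrs ∪ v.attrs ∪ v'.attrs

def Term.attrsList : List (Term A Δ) → Finset A
  | [] => ∅
  | v :: vs => v.attrs ∪ Term.attrsList vs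

/-- Attributes occurring in a filter. -/
def Filter.attrs : Filter A Δ → Finset A
  | .isNull V => Term.attrsList V
  | .eq v v' => v.attrs ∪ v'.attrs
  | .and F1 F2 => F1.attrs ∪ F2.attrs
  | .not F => F.attrs
end

/-- A term is over `U` if all its attributes are in `U`. -/
def Term.over (v : Term A Δ) (U : Finset A) : Prop := v.attrs ⊆ U

/-- A filter is over `U` if all its attributes are in `U`. -/
def Filter.over (F : Filter A Δ) (U : Finset A) : Prop := F.attrs ⊆ U

/-- A tuple is over `U` if its domain is exactly `U`. -/
def Tuple.isOver (t : Tuple A Δ) (U : Finset A) : Prop := ∀ a, (t a).isSome ↔ a ∈ U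

/-- A relation is a bag (multiset) of tuples. -/
abbrev Rel (A Δ : Type) := Multiset (Tuple A Δ)

/-- A relation is over `U` if all its tuples are. -/
def Rel.isOver (R : Rel A Δ) (U : Finset A) : Prop := ∀ t ∈ R, t.isOver U

/-- Selection σ_F. -/
def select (null : Δ) (F : Filter A Δ) (R : Rel A Δ) : Rel A Δ :=
  R.filter (fun t => F.eval null t = .tt)

/-- Restriction of a tuple to the attributes in `U`. -/
def Tuple.restrict (t : Tuple A Δ) (U : Finset A) : Tuple A Δ :=
  fun a => if a ∈ U then t a else none

/-- Projection π_U (bag semantics: multiplicities are added up). -/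
def proj (U : Finset A) (R : Rel A Δ) : Rel A Δ := R.map (·.restrict U)

/-- Bag difference: `(R1 ∖ R2)(t) = R1(t)` if `t ∉ R2` and `0` otherwise. -/
def bdiff (R1 R2 : Rel A Δ) : Rel A Δ := R1.filter (fun t => t ∉ R2)

/-- Compatibility of tuples: equal and non-null on the shared attributes. -/
def Compat (null : Δ) (t1 t2 : Tuple A Δ) : Prop :=
  ∀ a, (t1 a).isSome → (t2 a).isSome → (t1 a = t2 a ∧ t1 a ≠ some null)

/-- `t1 ⊕ t2`: the common extension of two (compatible) tuples. -/
def Tuple.merge (t1 t2 : Tuple A Δ) : Tuple A Δ :=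
  fun a => (t1 a).or (t2 a)

/-- Natural join. -/
def join (null : Δ) (R1 R2 : Rel A Δ) : Rel A Δ :=
  (R1.product R2).filterMap
    (fun p => if Compat null p.1 p.2 then some (p.1.merge p.2) else none)

/-- Natural join with a filter: `R1 ⋈_F R2 = σ_F (R1 ⋈ R2)`. -/
def joinF (null : Δ) (F : Filter A Δ) (R1 R2 : Rel A Δ) : Rel A Δ :=
  select null F (join null R1 R2)

/-- Padding of a tuple with `null` on the attributes of `V`. -/
def Tuple.pad (null : Δ) (V : Finset A) (t : Tuple A Δ) : Tuple A Δ :=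
  fun a => if a ∈ V then (t a).or (some null) else t a

/-- Outer union of `R1` over `U1` and `R2` over `U2`:
each relation is padded with nulls on the attributes missing from it. -/
def ounion (null : Δ) (U1 U2 : Finset A) (R1 R2 : Rel A Δ) : Rel A Δ :=
  R1.map (Tuple.pad null (U2 \ U1)) + R2.map (Tuple.pad null (U1 \ U2))

/-- Left join `R1 ⟕_F R2 = (R1 ⋈_F R2) ⊎ (R1 ∖ π_{U1}(R1 ⋈_F R2))`
for `R1` over `U1` and `R2` over `U2`. -/
def ljoin (null : Δ) (U1 U2 : Finset A) (F : Filter A Δ) (R1 R2 : Rel A Δ) : Rel A Δ :=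
  ounion null (U1 ∪ U2) U1 (joinF null F R1 R2) (bdiff R1 (proj U1 (joinF null F R1 R2)))

/-- Natural left join `R1 ⟕ R2 = R1 ⟕_⊤ R2`. -/
def nljoin (null : Δ) (U1 U2 : Finset A) (R1 R2 : Rel A Δ) : Rel A Δ :=
  ljoin null U1 U2 Filter.tru R1 R2

/-- Extension ν_{u↦v}. -/
def extend (null : Δ) (u : A) (v : Term A Δ) (R : Rel A Δ) : Rel A Δ :=
  R.map (fun t a => if a = u then some (v.eval null t) else t a)

/-- Duplicate elimination δ. -/
def dedup (R : Rel A Δ) : Rel A Δ := R.dedup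

/-- Extended renaming ρ^V_{{u/f(u) | u ∈ S}} at the level of tuples:
each attribute `u ∈ S` receives the value of the term `f u` (evaluated on the original
tuple) and the attributes of `V ∖ S` are projected away. -/
def renameFun (null : Δ) (V S : Finset A) (f : A → Term A Δ) (t : Tuple A Δ) : Tuple A Δ :=
  fun a => if a ∈ S then some ((f a).eval null t) else if a ∈ V then none else t a

/-- Extended renaming ρ^V_{{u/f(u) | u ∈ S}}. -/
def rename (null : Δ) (V S : Finset A) (f : A → Term A Δ) (R : Rel A Δ) : Rel A Δ :=
  R.map (renameFun null V S f)

/-- Renaming of the attribute `uold` into `unew` at the level of tuples. -/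
def renameAttrT (unew uold : A) (t : Tuple A Δ) : Tuple A Δ :=
  fun a => if a = unew then t uold else if a = uold then none else t a

/-- `R[unew/uold]`: the relation `R` with the attribute `uold` renamed to `unew`. -/
def renameAttr (unew uold : A) (R : Rel A Δ) : Rel A Δ := R.map (renameAttrT unew uold)

/-- `coalesce(v, v') = if(¬isNull(v), v, v')`. -/
def Term.coalesce (v v' : Term A Δ) : Term A Δ := .ite (.not (.isNull [v])) v v'

/-- The filter `⋀_{u ∈ K} ¬isNull(u)`. -/
def notNullAll (K : Finset A) : Filter A Δ :=
  K.toList.foldr (fun u acc => (Filter.not (.isNull [.attr u])).and acc) Filter.tru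

mutual
/-- `nullify_S`: replace every occurrence of an attribute from `S` by the constant null. -/
def Term.nullify (null : Δ) (S : Finset A) : Term A Δ → Term A Δ
  | .attr a => if a ∈ S then .const null else .attr a
  | .const c => .const c
  | .ite F v v' => .ite (F.nullify null S) (v.nullify null S) (v'.nullify null S)

def Term.nullifyList (null : Δ) (S : Finset A) : List (Term A Δ) → List (Term A Δ)
  | [] => []
  | v :: vs => v.nullify null S :: Term.nullifyList null S vs

/-- `nullify_S` on filters. -/
def Filter.nullify (null : Δ) (S : Finset A) : Filter A Δ → Filter A Δ
  | .isNull V => .isNull (Term.nullifyList null S V)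
  | .eq v v' => .eq (v.nullify null S) (v'.nullify null S)
  | .and F1 F2 => .and (F1.nullify null S) (F2.nullify null S)
  | .not F => .not (F.nullify null S)
end

/-- p-equivalence of filters over `U`: they are ⊤ on the same tuples over `U`. -/
def pequiv (null : Δ) (U : Finset A) (F1 F2 : Filter A Δ) : Prop :=
  ∀ t : Tuple A Δ, t.isOver U → (F1.eval null t = TV.tt ↔ F2.eval null t = TV.tt)

end RA

namespace RA

variable {A Δ : Type} [DecidableEq A] [DecidableEq Δ]

mutual
/-- The value of a term depends only on the attributes occurring in it. -/
theorem Term.eval_congr (null : Δ) {s t : Tuple A Δ} :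
    ∀ v : Term A Δ, (∀ a ∈ v.attrs, s a = t a) → v.eval null s = v.eval null t
  | .attr a, h => by
      have := h a (by simp [Term.attrs])
      simp [Term.eval, this]
  | .const c, _ => by simp [Term.eval]
  | .ite F v v', h => by
      have hF := Filter.eval_congr null F (fun a ha => h a (by simp [Term.attrs, ha]))
      have hv := Term.eval_congr null v (fun a ha => h a (by simp [Term.attrs, ha]))
      have hv' := Term.eval_congr null v' (fun a ha => h a (by simp [Term.attrs, ha]))
      simp only [Term.eval, hF, hv, hv']

theorem Term.evalList_congr (null : Δ) {s t : Tuple A Δ} :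
    ∀ V : List (Term A Δ), (∀ a ∈ Term.attrsList V, s a = t a) →
      Term.evalList null s V = Term.evalList null t V
  | [], _ => by simp [Term.evalList]
  | v :: vs, h => by
      have hv := Term.eval_congr null v (fun a ha => h a (by simp [Term.attrsList, ha]))
      have hvs := Term.evalList_congr null vs (fun a ha => h a (by simp [Term.attrsList, ha]))
      simp only [Term.evalList, hv, hvs]

/-- The truth value of a filter depends only on the attributes occurring in it. -/
theorem Filter.eval_congr (null : Δ) {s t : Tuple A Δ} :
    ∀ F : Filter A Δ, (∀ a ∈ F.attrs, s a = t a) → F.eval null s = F.eval null t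
  | .isNull V, h => by
      have hV := Term.evalList_congr null V (fun a ha => h a (by simpa [Filter.attrs] using ha))
      simp only [Filter.eval, hV]
  | .eq v v', h => by
      have hv := Term.eval_congr null v (fun a ha => h a (by simp [Filter.attrs, ha]))
      have hv' := Term.eval_congr null v' (fun a ha => h a (by simp [Filter.attrs, ha]))
      simp only [Filter.eval, hv, hv']
  | .and F G, h => by
      have hF := Filter.eval_congr null F (fun a ha => h a (by simp [Filter.attrs, ha]))
      have hG := Filter.eval_congr null G (fun a ha => h a (by simp [Filter.attrs, ha]))
      simp only [Filter.eval, hF, hG]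
  | .not F, h => by
      have hF := Filter.eval_congr null F (fun a ha => h a (by simpa [Filter.attrs] using ha))
      simp only [Filter.eval, hF]
end

theorem filterMap_congr_of_mem {α β : Type} {f g : α → Option β} (s : Multiset α)
    (h : ∀ x ∈ s, f x = g x) : s.filterMap f = s.filterMap g := by
  induction s using Quot.inductionOn with
  | _ l => exact congrArg Multiset.ofList (List.filterMap_congr h)

theorem product_map_right {α β γ : Type} (s : Multiset α) (t : Multiset β) (f : β → γ) :
    s.product (t.map f) = (s.product t).map (Prod.map id f) := by
  simp only [Multiset.product, Multiset.map_bind, Multiset.map_map]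
  rfl

theorem joinF_map_right (null : Δ) (F : Filter A Δ) (R1 R2 : Rel A Δ)
    (e r g : Tuple A Δ → Tuple A Δ)
    (hc : ∀ t1 ∈ R1, ∀ t2 ∈ R2, (Compat null t1 (r t2) ↔ Compat null t1 (e t2)))
    (hm : ∀ t1 ∈ R1, ∀ t2 ∈ R2, t1.merge (r t2) = g (t1.merge (e t2)))
    (hF : ∀ t, F.eval null (g t) = F.eval null t) :
    joinF null F R1 (R2.map r) = (joinF null F R1 (R2.map e)).map g := by
  have hj : join null R1 (R2.map r) = (join null R1 (R2.map e)).map g := by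
    simp only [join, product_map_right, Multiset.filterMap_map, Multiset.map_filterMap]
    refine filterMap_congr_of_mem _ ?_
    rintro ⟨t1, t2⟩ hp
    obtain ⟨h1, h2⟩ := Multiset.mem_product.1 hp
    by_cases h : Compat null t1 (e t2)
    · simp [h, hc t1 h1 t2 h2, hm t1 h1 t2 h2]
    · simp [h, hc t1 h1 t2 h2]
  rw [joinF, hj, joinF, select, select, Multiset.filter_map]
  simp only [Function.comp_def, hF]

theorem stmt8 (null : Δ) (U1 U2 : Finset A) (R1 R2 : Rel A Δ) (F : Filter A Δ) (u1 u2 : A)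
    (hR1 : R1.isOver U1) (hR2 : R2.isOver U2)
    (hu1 : u1 ∈ U1 \ U2) (hu2 : u2 ∈ U2 \ U1)
    (hF : F.over (U1 ∪ U2)) (hFu2 : u2 ∉ F.attrs) :
    proj ((U1 ∪ U2) \ {u2}) (ljoin null U1 (insert u1 U2) F R1 (extend null u1 (.attr u2) R2))
      = ljoin null U1 (insert u1 (U2.erase u2)) F R1 (renameAttr u1 u2 R2) := by
  obtain ⟨hu11, hu12⟩ := Finset.mem_sdiff.1 hu1
  obtain ⟨hu22, hu21⟩ := Finset.mem_sdiff.1 hu2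
  have hne : u2 ≠ u1 := fun h => hu21 (h ▸ hu11)
  have none_of : ∀ {t : Tuple A Δ} {U : Finset A}, t.isOver U → ∀ a ∉ U, t a = none :=
    fun ht a ha => by simpa using (ht a).not.2 ha
  have ext_u1 : ∀ t2 ∈ R2, some ((t2 u2).getD null) = t2 u2 := fun t2 h2 => by
    obtain ⟨d, hd⟩ := Option.isSome_iff_exists.1 ((hR2 t2 h2 u2).2 hu22)
    simp [hd]
  have hJ : joinF null F R1 (renameAttr u1 u2 R2)
      = (joinF null F R1 (extend null u1 (.attr u2) R2)).map (·.restrict ((U1 ∪ U2) \ {u2})) := by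
    refine joinF_map_right null F R1 R2 _ _ _ ?_ ?_ ?_
    · intro t1 h1 t2 h2
      refine forall_congr' fun a => ?_
      have h12 := none_of (hR1 t1 h1) u2 hu21
      by_cases ha2 : a = u2
      · simp [ha2, h12]
      · simp only [renameAttrT, Term.eval, ext_u1 t2 h2, ha2, if_false]
    · intro t1 h1 t2 h2
      funext a
      simp only [Tuple.merge, Tuple.restrict, renameAttrT, Term.eval, ext_u1 t2 h2]
      by_cases ha2 : a = u2
      · simp [ha2, none_of (hR1 t1 h1) u2 hu21, hne]
      · by_cases haU : a ∈ U1 ∪ U2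
        · simp [ha2, Finset.mem_union.1 haU]
        · have h := Finset.notMem_union.1 haU
          have ha1 : a ≠ u1 := fun h' => h.1 (h' ▸ hu11)
          simp [ha1, ha2, h.1, h.2, none_of (hR1 t1 h1) a h.1, none_of (hR2 t2 h2) a h.2]
    · intro t
      refine Filter.eval_congr null F fun a ha => ?_
      have : a ∈ (U1 ∪ U2) \ {u2} := by
        simp only [Finset.mem_sdiff, Finset.mem_singleton]
        exact ⟨hF ha, fun h => hFu2 (h ▸ ha)⟩
      simp only [Tuple.restrict, this, if_true]
  have hP : ∀ R : Rel A Δ, proj U1 (R.map (·.restrict ((U1 ∪ U2) \ {u2}))) = proj U1 R := by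
    intro R
    rw [proj, Multiset.map_map]
    refine Multiset.map_congr rfl fun t _ => ?_
    funext a
    by_cases ha : a ∈ U1
    · have : a ≠ u2 := fun h => hu21 (h ▸ ha)
      simp [Tuple.restrict, ha, this]
    · simp [Tuple.restrict, ha]
  have pad_empty : ∀ V : Finset A, V = ∅ → Tuple.pad null V = id := by
    rintro _ rfl
    funext t a
    simp [Tuple.pad]
  simp only [ljoin, ounion, hJ, hP]
  rw [pad_empty (U1 \ (U1 ∪ insert u1 U2)) (by grind),
    pad_empty (U1 \ (U1 ∪ insert u1 (U2.erase u2))) (by grind), proj, Multiset.map_add,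
    Multiset.map_id, Multiset.map_id, Multiset.map_map]
  congr 1
  refine Multiset.map_congr rfl fun t ht => ?_
  have ht1 := hR1 t (Multiset.mem_of_mem_filter ht)
  funext a
  by_cases ha2 : a = u2
  · simp [Tuple.restrict, Tuple.pad, ha2, hne, none_of ht1 u2 hu21]
  · by_cases ha1 : a ∈ U1
    · simp [Tuple.restrict, Tuple.pad, ha1, ha2]
    · have : a ≠ u1 := fun h => ha1 (h ▸ hu11)
      by_cases haU : a ∈ U2 <;>
        simp [Tuple.restrict, Tuple.pad, ha1, ha2, this, haU, none_of ht1 a ha1]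

end RA
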